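/- arXiv:math/9502203 — 2 statements merged into one kernel-verified Lean document; each statement's English description precedes it below -/
import Mathlib

section
/- In the amalgamation setting: for all m and n, if x ∈ Aₙ, y ∈ Aₘ, and x and y are compatible in <_t, then x and π_{mn}(y) are compatible in <ₙ, and π_{nm}(x) and y are compatible in <ₘ. In particular, for x, y ∈ Aₙ one has x ⊥_t y if and only if x ⊥ₙ y. -/
open Cardinal Set

noncomputable section

/-- A partial function from ordinals to ordinals, represented by its graph. -/
abbrev ColFun := Set (Ordinal × Ordinal)

/-- `q ∈ Col(X)`: `q` is (the graph of) a function whose domain is an ordinal `< ω₁`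
and whose range is a subset of `X`. -/
def IsColFun (X : Set Ordinal) (q : ColFun) : Prop :=
  (∀ a b b', (a, b) ∈ q → (a, b') ∈ q → b = b') ∧
  (∃ δ : Ordinal, δ < (aleph 1).ord ∧ ∀ a : Ordinal, (∃ b, (a, b) ∈ q) ↔ a < δ) ∧
  (∀ a b, (a, b) ∈ q → b ∈ X)

/-- A quadruple `((A, <), B, C, F)`; `F` is a partial function represented by its graph. -/
structure Quad where
  A : Set Ordinal
  lt : Ordinal → Ordinal → Prop
  B : Set (Ordinal × ColFun)
  C : Set (ℕ → Ordinal)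
  F : Set ((ℕ → Ordinal) × (Ordinal × ColFun) × ℕ)

namespace Quad

/-- `x ≤ᵣ y`. -/
def leR (r : Quad) (x y : Ordinal) : Prop := r.lt x y ∨ x = y

/-- `x ⊥ᵣ y`: no `z ∈ Aᵣ` with `z ≤ᵣ x` and `z ≤ᵣ y`. -/
def Incomp (r : Quad) (x y : Ordinal) : Prop := ¬ ∃ z ∈ r.A, r.leR z x ∧ r.leR z y

/-- `r` is a forcing condition. -/
def IsCond (r : Quad) : Prop :=
  -- (1) A is a countable set of ordinals < ω₂
  r.A.Countable ∧
  (∀ a ∈ r.A, a < (aleph 2).ord) ∧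
  -- (2) <ᵣ is a strict partial order on A
  (∀ a b, r.lt a b → a ∈ r.A ∧ b ∈ r.A) ∧
  (∀ a b c, r.lt a b → r.lt b c → r.lt a c) ∧
  -- (3) b <ᵣ a implies a < b (whence <ᵣ is irreflexive and asymmetric)
  (∀ a b, r.lt b a → a < b) ∧
  -- (4) B is a countable subset of A × Col(A) with p ∈ range q for (p,q) ∈ B
  r.B.Countable ∧
  (∀ pq ∈ r.B, pq.1 ∈ r.A ∧ IsColFun r.A pq.2 ∧ ∃ α, (α, pq.1) ∈ pq.2) ∧
  -- (5) C is a countable set of <ᵣ-descending sequences in A without lower bound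
  r.C.Countable ∧
  (∀ a ∈ r.C, (∀ n, a n ∈ r.A) ∧ (∀ n, r.lt (a (n + 1)) (a n)) ∧
    ¬ ∃ z ∈ r.A, ∀ n, r.leR z (a n)) ∧
  -- (6) F is a (partial) function whose domain consists exactly of the pairs
  -- (⟨aₙ⟩, (p,q)) with ⟨aₙ⟩ ∈ C, (p,q) ∈ B, p ≥ a₀, satisfying (*)
  (∀ x ∈ r.F, x.1 ∈ r.C ∧ x.2.1 ∈ r.B ∧ x.1 0 ≤ x.2.1.1) ∧
  (∀ a pq, a ∈ r.C → pq ∈ r.B → a 0 ≤ pq.1 → ∃! m : ℕ, (a, pq, m) ∈ r.F) ∧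
  (∀ a pq m, (a, pq, m) ∈ r.F →
    ∀ p'q' ∈ r.B, r.leR p'q'.1 pq.1 → pq.2 ⊆ p'q'.2 →
      r.lt p'q'.1 (a m) → ∃ k, r.Incomp p'q'.1 (a k))

/-- `Ext r s`: `r ≤_R s`, i.e. `r` is stronger than `s`. -/
def Ext (r s : Quad) : Prop :=
  s.A ⊆ r.A ∧
  (∀ a ∈ s.A, ∀ b ∈ s.A, (r.lt a b ↔ s.lt a b)) ∧
  (∀ a ∈ s.A, ∀ b ∈ s.A, (r.Incomp a b ↔ s.Incomp a b)) ∧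
  s.B ⊆ r.B ∧ s.C ⊆ r.C ∧ s.F ⊆ r.F

end Quad

open Quad

/-- Push a `Col`-function forward along a map of ordinals (acting on the range). -/
def mapCol (f : Ordinal → Ordinal) (q : ColFun) : ColFun :=
  {x | ∃ a b, (a, b) ∈ q ∧ x = (a, f b)}

/-- The amalgamation setting: a sequence of conditions forming a Δ-system with root `D`,
a commutative system of isomorphisms `π`, and descending chains `cⁿ` matched by `π`. -/
structure Amalg where
  r : ℕ → Quad
  cond : ∀ n, (r n).IsCond
  D : Set Ordinal
  inter : ∀ m n : ℕ, m < n → (r m).A ∩ (r n).A = D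
  supD_lt : ∀ m : ℕ, ∀ x ∈ (r m).A \ D, sSup D < x
  supA_lt : ∀ m n : ℕ, m < n → ∀ x ∈ (r n).A \ D, sSup (r m).A < x
  lt_agree : ∀ m n : ℕ, ∀ a ∈ D, ∀ b ∈ D, ((r m).lt a b ↔ (r n).lt a b)
  incomp_agree : ∀ m n : ℕ, ∀ a ∈ D, ∀ b ∈ D, ((r m).Incomp a b ↔ (r n).Incomp a b)
  B_agree : ∀ m n : ℕ, ∀ pq : Ordinal × ColFun, pq.1 ∈ D → IsColFun D pq.2 →
    (pq ∈ (r m).B ↔ pq ∈ (r n).B)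
  C_agree : ∀ m n : ℕ, ∀ a : ℕ → Ordinal, (∀ k, a k ∈ D) → (a ∈ (r m).C ↔ a ∈ (r n).C)
  pi : ℕ → ℕ → Ordinal → Ordinal
  pi_mem : ∀ m n : ℕ, ∀ x ∈ (r m).A, pi m n x ∈ (r n).A
  pi_id : ∀ m : ℕ, ∀ x ∈ (r m).A, pi m m x = x
  pi_inv : ∀ m n : ℕ, ∀ x ∈ (r m).A, pi n m (pi m n x) = x
  pi_comm : ∀ m n k : ℕ, ∀ x ∈ (r m).A, pi n k (pi m n x) = pi m k x
  pi_idD : ∀ m n : ℕ, ∀ x ∈ D, pi m n x = x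
  pi_iso : ∀ m n : ℕ, ∀ x ∈ (r m).A, ∀ y ∈ (r m).A,
    ((r m).lt x y ↔ (r n).lt (pi m n x) (pi m n y))
  pi_B : ∀ m n : ℕ, ∀ pq ∈ (r m).B, (pi m n pq.1, mapCol (pi m n) pq.2) ∈ (r n).B
  pi_C : ∀ m n : ℕ, ∀ a ∈ (r m).C, (fun k => pi m n (a k)) ∈ (r n).C
  pi_F : ∀ m n : ℕ, ∀ x ∈ (r m).F,
    ((fun k => pi m n (x.1 k)), (pi m n x.2.1.1, mapCol (pi m n) x.2.1.2), x.2.2) ∈ (r n).F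
  c : ℕ → ℕ → Ordinal
  c_mem : ∀ n k : ℕ, c n k ∈ (r n).A \ D
  c_dec : ∀ n k : ℕ, (r n).lt (c n (k + 1)) (c n k)
  pi_c : ∀ m n k : ℕ, pi m n (c m k) = c n k

namespace Amalg

/-- `A_t = ⋃ₙ Aₙ`. -/
def At (S : Amalg) : Set Ordinal := ⋃ n, (S.r n).A

/-- `<_t`: the transitive closure of the union of the `<ₙ` together with the pairs
`aⁿ⁺¹ₙ₊₁ <_t bⁿₙ` (recall `aⁿₖ = cⁿ₂ₖ` and `bⁿₖ = cⁿ₂ₖ₊₁`). -/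
def ltT (S : Amalg) : Ordinal → Ordinal → Prop :=
  Relation.TransGen (fun x y =>
    (∃ n, (S.r n).lt x y) ∨ ∃ n : ℕ, x = S.c (n + 1) (2 * (n + 1)) ∧ y = S.c n (2 * n + 1))

/-- `x ≤_t y`. -/
def leT (S : Amalg) (x y : Ordinal) : Prop := S.ltT x y ∨ x = y

/-- `x` and `y` are compatible in `<_t`. -/
def CompatT (S : Amalg) (x y : Ordinal) : Prop := ∃ z ∈ S.At, S.leT z x ∧ S.leT z y

end Amalg

namespace Amalg

theorem pi_eq_of_mem (S : Amalg) {m n : ℕ} (k : ℕ) {x : Ordinal}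
    (hm : x ∈ (S.r m).A) (hn : x ∈ (S.r n).A) : S.pi m k x = S.pi n k x := by
  rcases lt_trichotomy m n with h | rfl | h
  · have hD : x ∈ S.D := S.inter m n h ▸ ⟨hm, hn⟩
    rw [S.pi_idD m k x hD, S.pi_idD n k x hD]
  · rfl
  · have hD : x ∈ S.D := S.inter n m h ▸ ⟨hn, hm⟩
    rw [S.pi_idD m k x hD, S.pi_idD n k x hD]

theorem mem_of_lt (S : Amalg) {n : ℕ} {x y : Ordinal} (h : (S.r n).lt x y) :
    x ∈ (S.r n).A ∧ y ∈ (S.r n).A :=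
  (S.cond n).2.2.1 x y h

theorem lt_trans (S : Amalg) {n : ℕ} {x y z : Ordinal} (hxy : (S.r n).lt x y)
    (hyz : (S.r n).lt y z) : (S.r n).lt x z :=
  (S.cond n).2.2.2.1 x y z hxy hyz

/-- The generating relation of `<_t` is carried into `<ₖ` by the maps `π`: the added pairs become
consecutive terms of the descending chain `cᵏ`. -/
theorem exists_pi_lt_of_step (S : Amalg) (k : ℕ) {x y : Ordinal}
    (h : (∃ n, (S.r n).lt x y) ∨
      ∃ n : ℕ, x = S.c (n + 1) (2 * (n + 1)) ∧ y = S.c n (2 * n + 1)) :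
    ∃ m n, x ∈ (S.r m).A ∧ y ∈ (S.r n).A ∧ (S.r k).lt (S.pi m k x) (S.pi n k y) := by
  rcases h with ⟨n, h⟩ | ⟨n, rfl, rfl⟩
  · obtain ⟨hx, hy⟩ := S.mem_of_lt h
    exact ⟨n, n, hx, hy, (S.pi_iso n k x hx y hy).1 h⟩
  · refine ⟨n + 1, n, (S.c_mem _ _).1, (S.c_mem _ _).1, ?_⟩
    rw [S.pi_c, S.pi_c]
    exact S.c_dec k (2 * n + 1)

theorem exists_pi_lt_of_ltT (S : Amalg) (k : ℕ) {x y : Ordinal} (h : S.ltT x y) :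
    ∃ m n, x ∈ (S.r m).A ∧ y ∈ (S.r n).A ∧ (S.r k).lt (S.pi m k x) (S.pi n k y) := by
  induction h with
  | single h => exact S.exists_pi_lt_of_step k h
  | tail _ h ih =>
    obtain ⟨m, n, hx, hy, hxy⟩ := ih
    obtain ⟨i, j, hy', hz, hyz⟩ := S.exists_pi_lt_of_step k h
    rw [S.pi_eq_of_mem k hy' hy] at hyz
    exact ⟨m, j, hx, hz, S.lt_trans hxy hyz⟩

theorem leR_pi_of_leT (S : Amalg) {m n : ℕ} (k : ℕ) {x y : Ordinal} (hx : x ∈ (S.r m).A)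
    (hy : y ∈ (S.r n).A) (h : S.leT x y) : (S.r k).leR (S.pi m k x) (S.pi n k y) := by
  rcases h with h | rfl
  · obtain ⟨i, j, hx', hy', hxy⟩ := S.exists_pi_lt_of_ltT k h
    rw [S.pi_eq_of_mem k hx hx', S.pi_eq_of_mem k hy hy']
    exact Or.inl hxy
  · exact Or.inr (S.pi_eq_of_mem k hx hy)

theorem compat_pi_of_compatT (S : Amalg) {m n : ℕ} (k : ℕ) {x y : Ordinal} (hx : x ∈ (S.r n).A)
    (hy : y ∈ (S.r m).A) (h : S.CompatT x y) :
    ∃ z ∈ (S.r k).A, (S.r k).leR z (S.pi n k x) ∧ (S.r k).leR z (S.pi m k y) := by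
  obtain ⟨z, hz, hzx, hzy⟩ := h
  obtain ⟨i, hz⟩ := mem_iUnion.1 hz
  exact ⟨S.pi i k z, S.pi_mem i k z hz, S.leR_pi_of_leT k hz hx hzx, S.leR_pi_of_leT k hz hy hzy⟩

theorem leT_of_leR (S : Amalg) {n : ℕ} {x y : Ordinal} (h : (S.r n).leR x y) : S.leT x y :=
  h.imp (fun h => Relation.TransGen.single (Or.inl ⟨n, h⟩)) id

end Amalg

/-- Lemma 7(iii): if `x ∈ Aₙ`, `y ∈ Aₘ` are compatible in `<_t` then `x` and `π_{mn} y`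
are compatible in `<ₙ` and `π_{nm} x` and `y` are compatible in `<ₘ`; in particular for
`x, y ∈ Aₙ`, `x ⊥_t y ↔ x ⊥ₙ y`. -/
theorem stmt8 (S : Amalg) :
    (∀ m n : ℕ, ∀ x ∈ (S.r n).A, ∀ y ∈ (S.r m).A, S.CompatT x y →
      (∃ z ∈ (S.r n).A, (S.r n).leR z x ∧ (S.r n).leR z (S.pi m n y)) ∧
      (∃ z ∈ (S.r m).A, (S.r m).leR z (S.pi n m x) ∧ (S.r m).leR z y)) ∧
    (∀ n : ℕ, ∀ x ∈ (S.r n).A, ∀ y ∈ (S.r n).A, (¬ S.CompatT x y ↔ (S.r n).Incomp x y)) := by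
  have key : ∀ m n : ℕ, ∀ x ∈ (S.r n).A, ∀ y ∈ (S.r m).A, S.CompatT x y →
      (∃ z ∈ (S.r n).A, (S.r n).leR z x ∧ (S.r n).leR z (S.pi m n y)) ∧
      (∃ z ∈ (S.r m).A, (S.r m).leR z (S.pi n m x) ∧ (S.r m).leR z y) := by
    intro m n x hx y hy h
    have hn := S.compat_pi_of_compatT n hx hy h
    have hm := S.compat_pi_of_compatT m hx hy h
    rw [S.pi_id n x hx] at hn
    rw [S.pi_id m y hy] at hm
    exact ⟨hn, hm⟩
  refine ⟨key, fun n x hx y hy => not_congr ⟨fun h => ?_, ?_⟩⟩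
  · have hn := (key n n x hx y hy h).1
    rwa [S.pi_id n y hy] at hn
  · rintro ⟨z, hz, hzx, hzy⟩
    exact ⟨z, mem_iUnion.2 ⟨n, hz⟩, S.leT_of_leR hzx, S.leT_of_leR hzy⟩
end
end

section
/- The following two statements are equivalent: (a) every game-closed complete Boolean algebra is countably closed; (b) every complete subalgebra of a countably closed complete Boolean algebra is countably closed. -/
noncomputable section

variable {B : Type*} [CompleteBooleanAlgebra B]

/-- A position in the game `G(B)` relative to a subset `A ⊆ B`: an odd-length
`≤`-decreasing list of nonzero elements of `A` (listed as `[b₀, …, b₂ₙ]`). -/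
def ValidPos (A : Set B) (l : List B) : Prop :=
  Odd l.length ∧ l.Chain' (fun x y => y ≤ x) ∧ ∀ x ∈ l, x ∈ A ∧ x ≠ ⊥

/-- `σ` is a winning strategy for player II in the game `G` played on the subset `A` of `B`:
at every position `(b₀, …, b₂ₙ)` it answers with a nonzero `b₂ₙ₊₁ ∈ A`, `b₂ₙ₊₁ ≤ b₂ₙ`,
and every infinite play consistent with `σ` has a nonzero lower bound in `A`. -/
def IsWinningStrategyOn (A : Set B) (σ : List B → B) : Prop :=
  (∀ l : List B, ValidPos A l → σ l ∈ A ∧ σ l ≠ ⊥ ∧ ∀ h : l ≠ [], σ l ≤ l.getLast h) ∧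
  (∀ b : ℕ → B, (∀ n, b n ∈ A) → (∀ n, b n ≠ ⊥) → (∀ n, b (n + 1) ≤ b n) →
    (∀ n, b (2 * n + 1) = σ (List.ofFn fun i : Fin (2 * n + 1) => b i)) →
    ∃ z ∈ A, z ≠ ⊥ ∧ ∀ n, z ≤ b n)

/-- `A ⊆ B` (with the induced structure) is game-closed: player II has a winning
strategy in the descending-chain game on `A`. -/
def GameClosedOn (A : Set B) : Prop :=
  ∃ σ : List B → B, IsWinningStrategyOn A σ

/-- The complete Boolean algebra `B` is game-closed. -/
def GameClosed (B : Type*) [CompleteBooleanAlgebra B] : Prop :=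
  GameClosedOn (Set.univ : Set B)

/-- `A ⊆ B` (with the induced structure) is countably closed: the nonzero elements of `A`
have a dense σ-closed subset. -/
def CountablyClosedOn (A : Set B) : Prop :=
  ∃ S : Set B, S ⊆ A ∧ (∀ s ∈ S, s ≠ ⊥) ∧
    (∀ b ∈ A, b ≠ ⊥ → ∃ s ∈ S, s ≤ b) ∧
    (∀ f : ℕ → B, (∀ n, f n ∈ S) → (∀ n, f (n + 1) ≤ f n) → ∃ z ∈ S, ∀ n, z ≤ f n)

/-- The complete Boolean algebra `B` is countably closed. -/
def CountablyClosed (B : Type*) [CompleteBooleanAlgebra B] : Prop :=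
  CountablyClosedOn (Set.univ : Set B)

/-- `A` is a complete subalgebra of `B`: a Boolean subalgebra closed under arbitrary
suprema and infima computed in `B`. -/
def IsCompleteSubalgebra (A : Set B) : Prop :=
  (⊥ : B) ∈ A ∧ (⊤ : B) ∈ A ∧
  (∀ x ∈ A, xᶜ ∈ A) ∧ (∀ x ∈ A, ∀ y ∈ A, x ⊔ y ∈ A) ∧ (∀ x ∈ A, ∀ y ∈ A, x ⊓ y ∈ A) ∧
  (∀ S : Set B, S ⊆ A → sSup S ∈ A) ∧ (∀ S : Set B, S ⊆ A → sInf S ∈ A)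

universe u

/-- A system of histories `X` of a game in which player I plays nonzero elements of `B`:
`Ext x c y` says that `y` is the history obtained from `x` when player I plays `c` and player II
answers with `last y`. Player II never loses. -/
structure HistorySystem (B : Type u) [CompleteBooleanAlgebra B] where
  X : Type u
  last : X → B
  Ext : X → B → X → Prop
  root : X
  last_root : last root = ⊤
  exists_ext : ∀ x c, c ≠ ⊥ → c ≤ last x → ∃ y, Ext x c y
  last_ne_bot : ∀ {x c y}, Ext x c y → last y ≠ ⊥
  last_le : ∀ {x c y}, Ext x c y → last y ≤ c
  exists_bound : ∀ (x : ℕ → X) (c : ℕ → B), (∀ n, Ext (x n) (c n) (x (n + 1))) →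
    ∃ z, z ≠ ⊥ ∧ ∀ n, z ≤ last (x n)

/-- `f` restricted to the first `2 * n` indices is a play of `G(B)` in which player II
follows `σ`. -/
structure IsPartialPlay {B : Type u} [CompleteBooleanAlgebra B] (σ : List B → B)
    (n : ℕ) (f : ℕ → B) : Prop where
  ne_bot : ∀ i < 2 * n, f i ≠ ⊥
  le : ∀ i, i + 1 < 2 * n → f (i + 1) ≤ f i
  eq : ∀ k < n, f (2 * k + 1) = σ (List.ofFn fun i : Fin (2 * k + 1) => f i)

theorem validPos_ofFn {B : Type u} [CompleteBooleanAlgebra B] {f : ℕ → B} {n : ℕ}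
    (hne : ∀ i < 2 * n + 1, f i ≠ ⊥) (hle : ∀ i, i + 1 < 2 * n + 1 → f (i + 1) ≤ f i) :
    ValidPos Set.univ (List.ofFn fun i : Fin (2 * n + 1) => f i) := by
  refine ⟨by simp, List.isChain_ofFn.2 fun i hi => hle i hi, fun x hx => ⟨trivial, ?_⟩⟩
  obtain ⟨i, rfl⟩ := (List.mem_ofFn' _ _).1 hx
  exact hne i i.2

theorem IsPartialPlay.exists_extend {B : Type u} [CompleteBooleanAlgebra B] {σ : List B → B}
    (hσ : IsWinningStrategyOn Set.univ σ) {n : ℕ} {f : ℕ → B} (hf : IsPartialPlay σ n f)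
    {c : B} (hc : c ≠ ⊥) (hcf : n ≠ 0 → c ≤ f (2 * n - 1)) :
    ∃ g, IsPartialPlay σ (n + 1) g ∧ (∀ i < 2 * n, g i = f i) ∧ g (2 * n) = c := by
  set f₁ : ℕ → B := fun i => if i < 2 * n then f i else c with hf₁
  have hpos : ValidPos Set.univ (List.ofFn fun i : Fin (2 * n + 1) => f₁ i) := by
    apply validPos_ofFn
    · intro i _
      by_cases h : i < 2 * n
      · simpa [hf₁, h] using hf.ne_bot i h
      · simpa [hf₁, h] using hc
    · intro i hi
      by_cases h : i + 1 < 2 * n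
      · simpa [hf₁, h, show i < 2 * n by omega] using hf.le i h
      · obtain rfl : i = 2 * n - 1 := by omega
        simpa [hf₁, h, show 2 * n - 1 < 2 * n by omega] using hcf (by omega)
  obtain ⟨-, hne, hle⟩ := hσ.1 _ hpos
  set d := σ (List.ofFn fun i : Fin (2 * n + 1) => f₁ i) with hd
  have hdc : d ≤ c := by
    refine (hle (by simp)).trans (le_of_eq ?_)
    rw [List.getLast_ofFn]
    simp [hf₁]
  refine ⟨fun i => if i < 2 * n + 1 then f₁ i else d, ⟨?_, ?_, ?_⟩, ?_, ?_⟩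
  · intro i _
    by_cases h : i < 2 * n + 1
    · simpa [h] using (hpos.2.2 (f₁ i) ((List.mem_ofFn' _ _).2 ⟨⟨i, h⟩, rfl⟩)).2
    · simpa [h] using hne
  · intro i hi
    by_cases h : i + 1 < 2 * n + 1
    · simpa [h, show i < 2 * n + 1 by omega] using List.isChain_ofFn.1 hpos.2.1 i h
    · obtain rfl : i = 2 * n := by omega
      simpa [hf₁] using hdc
  · intro k hk
    by_cases h : k < n
    · have h₁ : ∀ i : Fin (2 * k + 1), (i : ℕ) < 2 * n ∧ (i : ℕ) < 2 * n + 1 :=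
        fun i => by omega
      simpa [hf₁, h₁, show 2 * k < 2 * n by omega, show 2 * k + 1 < 2 * n by omega] using hf.eq k h
    · obtain rfl : k = n := by omega
      simp [hd]
  · intro i hi
    simp [hf₁, hi, show i < 2 * n + 1 by omega]
  · simp [hf₁]

theorem IsWinningStrategyOn.exists_bound_of_partialPlays {B : Type u} [CompleteBooleanAlgebra B]
    {σ : List B → B} (hσ : IsWinningStrategyOn Set.univ σ) {N : ℕ → ℕ} {f : ℕ → ℕ → B}
    (hplay : ∀ k, IsPartialPlay σ (N k) (f k)) (hN : ∀ k, N (k + 1) = N k + 1)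
    (hf : ∀ k, ∀ i < 2 * N k, f (k + 1) i = f k i) :
    ∃ z, z ≠ ⊥ ∧ ∀ k, ∀ i < 2 * N k, z ≤ f k i := by
  have hNadd : ∀ j d, N (j + d) = N j + d := by
    intro j d
    induction d with
    | zero => rfl
    | succ d ih => rw [← add_assoc, hN, ih, add_assoc]
  have hcoh : ∀ j d, ∀ i < 2 * N j, f (j + d) i = f j i := by
    intro j d i hi
    induction d with
    | zero => rfl
    | succ d ih => rw [← add_assoc, hf _ _ (by rw [hNadd]; omega), ih]
  have hbig : ∀ i, i + 1 ≤ N (i + 1) := fun i => by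
    have := hNadd 0 (i + 1)
    rw [zero_add] at this
    omega
  have hlim : ∀ k, ∀ i < 2 * N k, f (i + 1) i = f k i := by
    intro k i hi
    have := hbig i
    rcases le_total (i + 1) k with h | h
    · obtain ⟨d, rfl⟩ := Nat.exists_eq_add_of_le h
      exact (hcoh _ _ _ (by omega)).symm
    · obtain ⟨d, hd⟩ := Nat.exists_eq_add_of_le h
      rw [hd, hcoh _ _ _ hi]
  obtain ⟨z, -, hz, hzle⟩ := hσ.2 (fun i => f (i + 1) i) (fun _ => trivial)
    (fun i => (hplay _).ne_bot _ (by have := hbig i; omega))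
    (fun i => by
      have := hbig (i + 1)
      show f (i + 1 + 1) (i + 1) ≤ f (i + 1) i
      rw [hlim (i + 1 + 1) i (by omega)]
      exact (hplay _).le _ (by omega))
    (fun n => by
      have := hbig (2 * n + 1)
      have heq := (hplay (2 * n + 1 + 1)).eq n (by omega)
      rw [heq]
      congr 2
      funext i
      exact (hlim _ _ (by omega)).symm)
  exact ⟨z, hz, fun k i hi => hlim k i hi ▸ hzle i⟩

/-- The histories of `G(B)` in which player II follows a winning strategy. -/
def IsWinningStrategyOn.historySystem {B : Type u} [CompleteBooleanAlgebra B] {σ : List B → B}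
    (hσ : IsWinningStrategyOn Set.univ σ) : HistorySystem B where
  X := {x : ℕ × (ℕ → B) // IsPartialPlay σ x.1 x.2}
  last x := if x.1.1 = 0 then ⊤ else x.1.2 (2 * x.1.1 - 1)
  Ext x c y := y.1.1 = x.1.1 + 1 ∧ (∀ i < 2 * x.1.1, y.1.2 i = x.1.2 i) ∧ y.1.2 (2 * x.1.1) = c
  root := ⟨(0, fun _ => ⊤), by constructor <;> simp⟩
  last_root := by simp
  exists_ext := by
    rintro ⟨⟨n, f⟩, hf⟩ c hc hcf
    obtain ⟨g, hg, hgf, hgc⟩ := hf.exists_extend hσ hc fun hn => by simpa [hn] using hcf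
    exact ⟨⟨(n + 1, g), hg⟩, rfl, hgf, hgc⟩
  last_ne_bot := by
    rintro ⟨⟨n, f⟩, hf⟩ c ⟨⟨m, g⟩, hg⟩ ⟨h, -, -⟩
    obtain rfl : m = n + 1 := h
    simpa using hg.ne_bot (2 * (n + 1) - 1) (by omega)
  last_le := by
    rintro ⟨⟨n, f⟩, hf⟩ c ⟨⟨m, g⟩, hg⟩ ⟨h, -, hc⟩
    obtain rfl : m = n + 1 := h
    have := hg.le (2 * n) (by omega)
    exact hc ▸ this
  exists_bound := by
    intro x c hx
    obtain ⟨z, hz, hzle⟩ := hσ.exists_bound_of_partialPlays (fun k => (x k).2)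
      (fun k => (hx k).1) (fun k => (hx k).2.1)
    refine ⟨z, hz, fun n => ?_⟩
    by_cases h : (x n).1.1 = 0
    · simp [h]
    · simpa [h] using hzle n (2 * (x n).1.1 - 1) (by omega)

/-- A strict partial order `r` on `Q`, closed under descending `ω`-sequences and branching below
every element, with a projection `π` to the nonzero elements of `B`. -/
structure StrictProjection (B : Type u) [CompleteBooleanAlgebra B] where
  Q : Type u
  r : Q → Q → Prop
  π : Q → B
  trans : ∀ {x y z}, r x y → r y z → r x z
  irrefl : ∀ x, ¬ r x x
  ne_bot : ∀ x, π x ≠ ⊥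
  mono : ∀ {x y}, r x y → π x ≤ π y
  closed : ∀ f : ℕ → Q, (∀ n, r (f (n + 1)) (f n)) → ∃ z, ∀ n, r z (f n)
  split : ∀ q b, b ≠ ⊥ → b ≤ π q →
    ∃ s t, (r s q ∧ π s ≤ b) ∧ (r t q ∧ π t ≤ b) ∧ s ≠ t ∧ ¬ r s t ∧ ¬ r t s
  dense : ∀ b, b ≠ ⊥ → ∃ q, π q ≤ b

namespace HistorySystem

variable {B : Type u} [CompleteBooleanAlgebra B] (G : HistorySystem B)

/-- A nonzero element `val` of `B` lying below the last moves of countably many histories. The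
set of `tags` only serves to make the order on conditions strict and branching. -/
structure Cond where
  val : B
  hist : Set G.X
  tags : Set (Set ℕ)
  val_ne_bot : val ≠ ⊥
  hist_countable : hist.Countable
  hist_nonempty : hist.Nonempty
  tags_countable : tags.Countable
  val_le : ∀ h ∈ hist, val ≤ G.last h

variable {G}

/-- The order on conditions: every history of `q` is continued in `p` by a move below `q.val`. -/
def Cond.Lt (p q : G.Cond) : Prop :=
  p.val ≤ q.val ∧ q.hist ⊆ p.hist ∧ q.tags ⊂ p.tags ∧
    ∀ h ∈ q.hist, ∃ h' ∈ p.hist, ∃ c ≤ q.val, G.Ext h c h'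

theorem Cond.Lt.trans {p q s : G.Cond} (h₁ : p.Lt q) (h₂ : q.Lt s) : p.Lt s := by
  refine ⟨h₁.1.trans h₂.1, h₂.2.1.trans h₁.2.1, h₂.2.2.1.trans h₁.2.2.1, fun h hh => ?_⟩
  obtain ⟨h', hh', c⟩ := h₂.2.2.2 h hh
  exact ⟨h', h₁.2.1 hh', c⟩

theorem Cond.exists_lt_of_seq (f : ℕ → G.Cond) (hf : ∀ n, (f (n + 1)).Lt (f n)) :
    ∃ z : G.Cond, ∀ n, z.Lt (f n) := by
  choose! e he c hc hext using fun n => (hf n).2.2.2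
  obtain ⟨h₀, hh₀⟩ := (f 0).hist_nonempty
  let x : ℕ → G.X := fun n => Nat.rec h₀ (fun n h => e n h) n
  have hx : ∀ n, x n ∈ (f n).hist := by
    intro n
    induction n with
    | zero => exact hh₀
    | succ n ih => exact he n _ ih
  have hxe : ∀ n, G.Ext (x n) (c n (x n)) (x (n + 1)) := fun n => hext n _ (hx n)
  obtain ⟨z, hz, hzx⟩ := G.exists_bound x _ hxe
  have hzf : ∀ n, z ≤ (f n).val := fun n =>
    (hzx (n + 1)).trans ((G.last_le (hxe n)).trans (hc n _ (hx n)))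
  refine ⟨⟨z, ⋃ n, (f n).hist, ⋃ n, (f n).tags, hz,
    Set.countable_iUnion fun n => (f n).hist_countable,
    ⟨h₀, Set.mem_iUnion.2 ⟨0, hh₀⟩⟩, Set.countable_iUnion fun n => (f n).tags_countable, ?_⟩, ?_⟩
  · intro h hh
    obtain ⟨n, hn⟩ := Set.mem_iUnion.1 hh
    exact (hzf n).trans ((f n).val_le h hn)
  · refine fun n => ⟨hzf n, Set.subset_iUnion (fun n => (f n).hist) n,
      (hf n).2.2.1.trans_subset (Set.subset_iUnion (fun n => (f n).tags) (n + 1)), fun h hh => ?_⟩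
    exact ⟨_, Set.mem_iUnion.2 ⟨n + 1, he n h hh⟩, _, hc n h hh, hext n h hh⟩

theorem Cond.exists_histories (q : G.Cond) {b : B} (hb : b ≠ ⊥) (hbq : b ≤ q.val) :
    ∃ z, ∃ H : Set G.X, z ≠ ⊥ ∧ z ≤ b ∧ H.Countable ∧ (∀ h ∈ H, z ≤ G.last h) ∧
      ∀ h ∈ q.hist, ∃ h' ∈ H, ∃ c ≤ q.val, G.Ext h c h' := by
  obtain ⟨h, hh⟩ := q.hist_countable.exists_eq_range q.hist_nonempty
  have hmem : ∀ i, h i ∈ q.hist := fun i => hh ▸ Set.mem_range_self i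
  let M := {m : G.X // G.last m ≠ ⊥ ∧ G.last m ≤ b}
  have hstep : ∀ (i : ℕ) (m : M), ∃ (m' : M) (g : G.X),
      G.Ext (h i) (G.last m.1) g ∧ G.Ext m.1 (G.last g) m'.1 := by
    rintro i ⟨m, hm, hmb⟩
    obtain ⟨g, hg⟩ := G.exists_ext (h i) (G.last m) hm
      (hmb.trans (hbq.trans (q.val_le _ (hmem i))))
    obtain ⟨m', hm'⟩ := G.exists_ext m (G.last g) (G.last_ne_bot hg) (G.last_le hg)
    exact ⟨⟨m', G.last_ne_bot hm',
      (G.last_le hm').trans ((G.last_le hg).trans hmb)⟩, g, hg, hm'⟩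
  choose next g hg hnext using hstep
  obtain ⟨m₀, hm₀⟩ := G.exists_ext G.root b hb (by simp [G.last_root])
  let m : ℕ → M := fun n =>
    Nat.rec ⟨m₀, G.last_ne_bot hm₀, G.last_le hm₀⟩ (fun i m => next i m) n
  have hm : ∀ i, G.Ext (m i).1 (G.last (g i (m i))) (m (i + 1)).1 := fun i => hnext i (m i)
  obtain ⟨z, hz, hzm⟩ := G.exists_bound (fun i => (m i).1) _ hm
  refine ⟨z, Set.range fun i => g i (m i), hz, (hzm 0).trans (m 0).2.2,
    Set.countable_range _, ?_, ?_⟩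
  · rintro _ ⟨i, rfl⟩
    exact (hzm (i + 1)).trans (G.last_le (hm i))
  · intro k hk
    obtain ⟨i, rfl⟩ := hh ▸ hk
    exact ⟨_, ⟨i, rfl⟩, _, (m i).2.2.trans hbq, hg i (m i)⟩

theorem exists_notMem_of_countable {T : Set (Set ℕ)} (hT : T.Countable) : ∃ s, s ∉ T := by
  by_contra! h
  rw [Set.eq_univ_of_forall h, Set.countable_univ_iff] at hT
  exact Function.cantor_surjective _ (exists_surjective_nat (Set ℕ)).choose_spec

theorem Cond.exists_split (q : G.Cond) {b : B} (hb : b ≠ ⊥) (hbq : b ≤ q.val) :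
    ∃ s t : G.Cond, (s.Lt q ∧ s.val ≤ b) ∧ (t.Lt q ∧ t.val ≤ b) ∧
      s ≠ t ∧ ¬ s.Lt t ∧ ¬ t.Lt s := by
  obtain ⟨z, H, hz, hzb, hH, hzH, hext⟩ := q.exists_histories hb hbq
  obtain ⟨u, hu⟩ := exists_notMem_of_countable q.tags_countable
  obtain ⟨v, hv⟩ := exists_notMem_of_countable (q.tags_countable.insert u)
  rw [Set.mem_insert_iff, not_or] at hv
  let p : Set ℕ → G.Cond := fun w =>
    ⟨z, q.hist ∪ H, insert w q.tags, hz, q.hist_countable.union hH,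
      q.hist_nonempty.mono Set.subset_union_left, q.tags_countable.insert w,
      fun h hh => hh.elim (fun hh => hzb.trans (hbq.trans (q.val_le h hh))) (hzH h)⟩
  have hp : ∀ w, w ∉ q.tags → (p w).Lt q ∧ (p w).val ≤ b := fun w hw =>
    ⟨⟨hzb.trans hbq, Set.subset_union_left, Set.ssubset_insert hw, fun h hh =>
      let ⟨h', hh', hc⟩ := hext h hh
      ⟨h', Or.inr hh', hc⟩⟩, hzb⟩
  have huv : ¬ (p u).tags ⊆ (p v).tags := fun h =>
    ((h (Set.mem_insert u _)).elim (fun h => hv.1 h.symm) hu)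
  have hvu : ¬ (p v).tags ⊆ (p u).tags := fun h =>
    ((h (Set.mem_insert v _)).elim hv.1 hv.2)
  exact ⟨p u, p v, hp u hu, hp v hv.2, fun h => huv (h ▸ subset_rfl),
    fun h => hvu h.2.2.1.subset, fun h => huv h.2.2.1.subset⟩

variable (G) in
/-- The conditions, projected to `B` by `Cond.val`. -/
def strictProjection : StrictProjection B where
  Q := G.Cond
  r := Cond.Lt
  π := Cond.val
  trans := Cond.Lt.trans
  irrefl _ h := h.2.2.1.ne rfl
  ne_bot := Cond.val_ne_bot
  mono h := h.1
  closed := Cond.exists_lt_of_seq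
  split q _ := q.exists_split
  dense b hb := ⟨⟨b, {G.root}, ∅, hb, Set.countable_singleton _, Set.singleton_nonempty _,
    Set.countable_empty, by simp [G.last_root]⟩, le_rfl⟩

end HistorySystem

namespace StrictProjection

variable {B : Type u} [CompleteBooleanAlgebra B] (R : StrictProjection B)

theorem exists_lt_of_weak_seq (f : ℕ → R.Q) (hf : ∀ n, f (n + 1) = f n ∨ R.r (f (n + 1)) (f n)) :
    ∃ z, ∀ n, R.r z (f n) := by
  have hle : ∀ n d, f (n + d) = f n ∨ R.r (f (n + d)) (f n) := by
    intro n d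
    induction d with
    | zero => exact Or.inl rfl
    | succ d ih =>
      rw [← add_assoc]
      rcases hf (n + d) with h | h
      · rwa [h]
      · exact Or.inr (ih.elim (fun e => e ▸ h) (R.trans h))
  have hbelow : ∀ {z n m}, n ≤ m → R.r z (f m) → R.r z (f n) := by
    intro z n m hnm hz
    obtain ⟨d, rfl⟩ := Nat.exists_eq_add_of_le hnm
    exact (hle n d).elim (fun e => e ▸ hz) (R.trans hz)
  by_cases hconst : ∃ N, ∀ d, f (N + d) = f N
  · obtain ⟨N, hN⟩ := hconst
    obtain ⟨z, -, ⟨hz, -⟩, -⟩ := R.split (f N) _ (R.ne_bot _) le_rfl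
    refine ⟨z, fun n => hbelow (Nat.le_add_left n N) ?_⟩
    rwa [hN]
  · push Not at hconst
    choose d hd using hconst
    let k : ℕ → ℕ := fun n => Nat.rec 0 (fun _ m => m + d m) n
    have hk : ∀ n, R.r (f (k (n + 1))) (f (k n)) := fun n => (hle _ _).resolve_left (hd (k n))
    have hnk : ∀ n, n ≤ k n := by
      intro n
      induction n with
      | zero => exact Nat.zero_le _
      | succ n ih =>
        have : d (k n) ≠ 0 := fun h => hd (k n) (by rw [h, add_zero])
        show n + 1 ≤ k n + d (k n)
        omega
    obtain ⟨z, hz⟩ := R.closed (f ∘ k) hk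
    exact ⟨z, fun n => hbelow (hnk n) (hz n)⟩

/-- A chain in `Q` with a least element. -/
structure Chain where
  carrier : Set R.Q
  min : R.Q
  min_mem : min ∈ carrier
  total : ∀ x ∈ carrier, ∀ y ∈ carrier, x = y ∨ R.r x y ∨ R.r y x
  min_le : ∀ x ∈ carrier, x = min ∨ R.r min x

variable {R}

namespace Chain

/-- `C ≤ D` if `C` is obtained from `D` by adding elements below `D`. -/
instance : LE R.Chain where
  le C D := D.carrier ⊆ C.carrier ∧ ∀ x ∈ C.carrier, x ∉ D.carrier → R.r x D.min

theorem min_eq_or_lt {C D : R.Chain} (h : C ≤ D) : C.min = D.min ∨ R.r C.min D.min :=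
  (C.min_le _ (h.1 D.min_mem)).imp_left Eq.symm

instance : Preorder R.Chain where
  le_refl _ := ⟨subset_rfl, fun _ h h' => absurd h h'⟩
  le_trans C D E hCD hDE := by
    refine ⟨hDE.1.trans hCD.1, fun x hx hxE => ?_⟩
    by_cases hxD : x ∈ D.carrier
    · exact hDE.2 x hxD hxE
    · have := hCD.2 x hx hxD
      exact (min_eq_or_lt hDE).elim (fun e => e ▸ this) (R.trans this)

theorem le_or_le_of_le {C D E : R.Chain} (hC : E ≤ C) (hD : E ≤ D) : C ≤ D ∨ D ≤ C := by
  by_cases hDC : D.carrier ⊆ C.carrier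
  · exact Or.inl ⟨hDC, fun x hx hxD => hD.2 x (hC.1 hx) hxD⟩
  by_cases hCD : C.carrier ⊆ D.carrier
  · exact Or.inr ⟨hCD, fun x hx hxC => hC.2 x (hD.1 hx) hxC⟩
  obtain ⟨y, hyD, hyC⟩ := Set.not_subset.1 hDC
  obtain ⟨x, hxC, hxD⟩ := Set.not_subset.1 hCD
  have hx := hD.2 x (hC.1 hxC) hxD
  have hy := hC.2 y (hD.1 hyD) hyC
  have hxy : R.r x y := (D.min_le y hyD).elim (fun e => e ▸ hx) (R.trans hx)
  have hyx : R.r y x := (C.min_le x hxC).elim (fun e => e ▸ hy) (R.trans hy)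
  exact absurd (R.trans hxy hyx) (R.irrefl x)

/-- Extend a chain by an element below it. -/
def cons (C : R.Chain) (q : R.Q) (hq : R.r q C.min) : R.Chain :=
  have hlt : ∀ x ∈ C.carrier, R.r q x := fun x hx =>
    (C.min_le x hx).elim (fun e => e ▸ hq) (R.trans hq)
  { carrier := insert q C.carrier
    min := q
    min_mem := Set.mem_insert _ _
    total := by
      rintro x (rfl | hx) y (rfl | hy)
      · exact Or.inl rfl
      · exact Or.inr (Or.inl (hlt y hy))
      · exact Or.inr (Or.inr (hlt x hx))
      · exact C.total x hx y hy
    min_le := fun x hx => hx.imp_right (hlt x) }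

theorem cons_le (C : R.Chain) (q : R.Q) (hq : R.r q C.min) : C.cons q hq ≤ C :=
  ⟨Set.subset_insert _ _, fun _ hx hxC => hx.elim (fun e => e ▸ hq) fun h => absurd h hxC⟩

theorem le_of_forall_compatible {C D : R.Chain} (h : ∀ E ≤ C, ∃ F ≤ E, F ≤ D) : C ≤ D := by
  obtain ⟨F, hFC, hFD⟩ := h C le_rfl
  refine (le_or_le_of_le hFC hFD).elim id fun hDC => ?_
  obtain ⟨s, t, ⟨hs, -⟩, ⟨ht, -⟩, hne, hst, hts⟩ := R.split C.min _ (R.ne_bot _) le_rfl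
  obtain ⟨q, hq, hqD⟩ : ∃ q, R.r q C.min ∧ q ∉ D.carrier := by
    by_contra! hall
    rcases D.total s (hall s hs) t (hall t ht) with h | h | h
    exacts [hne h, hst h, hts h]
  obtain ⟨F, hFE, hFD⟩ := h (C.cons q hq) (C.cons_le q hq)
  rcases le_or_le_of_le hFE hFD with h | h
  · have hsub : D.carrier ⊆ C.carrier := fun x hx =>
      (h.1 hx).elim (fun e => absurd (e ▸ hx) hqD) id
    exact ⟨hsub, fun x hx hxD => absurd (hDC.1 hx) hxD⟩
  · exact absurd (h.1 (Set.mem_insert _ _)) hqD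

theorem exists_le_of_seq (f : ℕ → R.Chain) (hf : ∀ n, f (n + 1) ≤ f n) :
    ∃ E : R.Chain, ∀ n, E ≤ f n := by
  have hanti : Antitone f := antitone_nat_of_succ_le hf
  obtain ⟨z, hz⟩ := R.exists_lt_of_weak_seq (fun n => (f n).min) fun n => min_eq_or_lt (hf n)
  have hlt : ∀ x ∈ ⋃ n, (f n).carrier, R.r z x := by
    intro x hx
    obtain ⟨n, hn⟩ := Set.mem_iUnion.1 hx
    exact ((f n).min_le x hn).elim (fun e => e ▸ hz n) (R.trans (hz n))
  refine ⟨⟨insert z (⋃ n, (f n).carrier), z, Set.mem_insert _ _, ?_,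
    fun x hx => hx.imp_right (hlt x)⟩, fun n => ⟨?_, ?_⟩⟩
  · rintro x (rfl | hx) y (rfl | hy)
    · exact Or.inl rfl
    · exact Or.inr (Or.inl (hlt y hy))
    · exact Or.inr (Or.inr (hlt x hx))
    · obtain ⟨n, hn⟩ := Set.mem_iUnion.1 hx
      obtain ⟨m, hm⟩ := Set.mem_iUnion.1 hy
      exact (f (max n m)).total x ((hanti (le_max_left n m)).1 hn) y
        ((hanti (le_max_right n m)).1 hm)
  · exact (Set.subset_iUnion (fun n => (f n).carrier) n).trans (Set.subset_insert _ _)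
  · rintro x (rfl | hx) hxn
    · exact hz n
    · obtain ⟨m, hm⟩ := Set.mem_iUnion.1 hx
      rcases le_total m n with h | h
      · exact absurd ((hanti h).1 hm) hxn
      · exact (hanti h).2 x hm hxn

theorem exists_le_of_le_min (C : R.Chain) {b : B} (hb : b ≠ ⊥) (hbC : b ≤ R.π C.min) :
    ∃ D ≤ C, R.π D.min ≤ b := by
  obtain ⟨s, -, ⟨hs, hsb⟩, -⟩ := R.split C.min b hb hbC
  exact ⟨C.cons s hs, C.cons_le s hs, hsb⟩

theorem exists_min_le {b : B} (hb : b ≠ ⊥) : ∃ C : R.Chain, R.π C.min ≤ b := by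
  obtain ⟨q, hq⟩ := R.dense b hb
  exact ⟨⟨{q}, q, rfl, fun x hx y hy => Or.inl (hx.trans hy.symm), fun x hx => Or.inl hx⟩, hq⟩

theorem min_mono {C D : R.Chain} (h : C ≤ D) : R.π C.min ≤ R.π D.min :=
  (min_eq_or_lt h).elim (fun e => e ▸ le_rfl) R.mono

end Chain

end StrictProjection

namespace Heyting.Regular

instance {α : Type u} [Order.Frame α] : CompleteBooleanAlgebra (Regular α) where
  __ := (inferInstance : BooleanAlgebra (Regular α))
  __ := gi.liftCompleteLattice

end Heyting.Regular

theorem LowerSet.mem_compl_iff_forall_le {P : Type u} [Preorder P] {s : LowerSet P} {p : P} :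
    p ∈ sᶜ ↔ ∀ q ≤ p, q ∉ s := by
  rw [← LowerSet.Iic_le, le_compl_iff_disjoint_right, disjoint_iff_inf_le]
  exact ⟨fun h q hq hqs => h (show q ∈ LowerSet.Iic p ⊓ s from ⟨hq, hqs⟩),
    fun h q hq => h q hq.1 hq.2⟩

theorem LowerSet.isRegular_of_forall {P : Type u} [Preorder P] {s : LowerSet P}
    (h : ∀ p, (∀ q ≤ p, ∃ t ≤ q, t ∈ s) → p ∈ s) : Heyting.IsRegular s := by
  refine le_antisymm (fun p hp => h p fun q hq => ?_) le_compl_compl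
  simpa [LowerSet.mem_compl_iff_forall_le] using LowerSet.mem_compl_iff_forall_le.1 hp q hq

open Heyting in
theorem countablyClosed_regular {P : Type u} [Preorder P]
    (hsep : ∀ p q : P, (∀ r ≤ p, ∃ s ≤ r, s ≤ q) → p ≤ q)
    (hclosed : ∀ f : ℕ → P, (∀ n, f (n + 1) ≤ f n) → ∃ z, ∀ n, z ≤ f n) :
    CountablyClosed (Regular (LowerSet P)) := by
  let i : P → Regular (LowerSet P) := fun p =>
    ⟨LowerSet.Iic p, LowerSet.isRegular_of_forall fun q => hsep q p⟩
  have hi : ∀ {p} {s : Regular (LowerSet P)}, i p ≤ s ↔ p ∈ s.val := fun {p s} =>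
    Regular.coe_le_coe.symm.trans LowerSet.Iic_le
  refine ⟨Set.range i, Set.subset_univ _, ?_, ?_, ?_⟩
  · rintro _ ⟨p, rfl⟩ h
    exact hi.1 h.le
  · intro b _ hb
    by_contra! h
    refine hb (le_bot_iff.1 fun p hp => ?_)
    exact absurd (hi.2 hp) (h _ ⟨p, rfl⟩)
  · intro f hf hle
    choose p hp using hf
    obtain rfl : (fun n => i (p n)) = f := funext hp
    obtain ⟨z, hz⟩ := hclosed p fun n => hi.1 (hle n)
    exact ⟨i z, ⟨z, rfl⟩, fun n => hi.2 (hz n)⟩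

/-- A complete embedding of complete Boolean algebras. -/
structure IsCompleteEmbedding {A C : Type u} [CompleteBooleanAlgebra A] [CompleteBooleanAlgebra C]
    (e : A → C) : Prop where
  le_iff : ∀ {x y}, e x ≤ e y ↔ x ≤ y
  map_compl : ∀ x, e xᶜ = (e x)ᶜ
  map_sInf : ∀ s, e (sInf s) = sInf (e '' s)

namespace IsCompleteEmbedding

variable {A C : Type u} [CompleteBooleanAlgebra A] [CompleteBooleanAlgebra C] {e : A → C}

theorem map_bot (he : IsCompleteEmbedding e) : e ⊥ = ⊥ := by
  have := he.map_sInf ∅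
  rw [← compl_top, he.map_compl]
  simpa using this

theorem map_sSup (he : IsCompleteEmbedding e) (s : Set A) : e (sSup s) = sSup (e '' s) := by
  rw [← compl_inj_iff, ← he.map_compl, compl_sSup', he.map_sInf, compl_sSup']
  congr 1
  simp only [Set.image_image, he.map_compl]

theorem isCompleteSubalgebra_range (he : IsCompleteEmbedding e) :
    IsCompleteSubalgebra (Set.range e) := by
  have hsup : ∀ S ⊆ Set.range e, sSup S ∈ Set.range e := fun S hS => by
    obtain ⟨s, rfl⟩ := Set.subset_range_iff_exists_image_eq.1 hS
    exact ⟨_, he.map_sSup s⟩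
  have hinf : ∀ S ⊆ Set.range e, sInf S ∈ Set.range e := fun S hS => by
    obtain ⟨s, rfl⟩ := Set.subset_range_iff_exists_image_eq.1 hS
    exact ⟨_, he.map_sInf s⟩
  refine ⟨⟨_, he.map_bot⟩, ?_, ?_, ?_, ?_, hsup, hinf⟩
  · simpa using hinf ∅ (Set.empty_subset _)
  · rintro _ ⟨x, rfl⟩
    exact ⟨_, he.map_compl x⟩
  · intro x hx y hy
    simpa using hsup {x, y} (Set.pair_subset hx hy)
  · intro x hx y hy
    simpa using hinf {x, y} (Set.pair_subset hx hy)

theorem countablyClosed (he : IsCompleteEmbedding e) (h : CountablyClosedOn (Set.range e)) :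
    CountablyClosed A := by
  obtain ⟨S, hS, hne, hdense, hclosed⟩ := h
  refine ⟨e ⁻¹' S, Set.subset_univ _, ?_, ?_, ?_⟩
  · rintro _ hs rfl
    exact hne _ hs he.map_bot
  · intro b _ hb
    obtain ⟨s, hs, hsb⟩ := hdense (e b) ⟨b, rfl⟩ fun h =>
      hb (le_bot_iff.1 (he.le_iff.1 (h.trans he.map_bot.symm).le))
    obtain ⟨a, rfl⟩ := hS hs
    exact ⟨a, hs, he.le_iff.1 hsb⟩
  · intro f hf hle
    obtain ⟨z, hz, hzf⟩ := hclosed (e ∘ f) hf fun n => he.le_iff.2 (hle n)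
    obtain ⟨a, rfl⟩ := hS hz
    exact ⟨a, hz, fun n => he.le_iff.1 (hzf n)⟩

/-- Player II wins by descending in a dense σ-closed subset of the larger algebra and playing
the upward projections of the elements of that subset. -/
theorem gameClosed (he : IsCompleteEmbedding e) (hC : CountablyClosed C) : GameClosed A := by
  classical
  obtain ⟨S, -, hne, hdense, hclosed⟩ := hC
  have hpick : ∀ x : C, ∃ y ≤ x, (x ≠ ⊥ → y ∈ S) ∧ (x ∈ S → y = x) := by
    intro x
    by_cases hx : x ∈ S
    · exact ⟨x, le_rfl, fun _ => hx, fun _ => rfl⟩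
    · by_cases h : x = ⊥
      · exact ⟨x, le_rfl, fun h' => absurd h h', fun _ => rfl⟩
      · obtain ⟨s, hs, hsx⟩ := hdense x trivial h
        exact ⟨s, hsx, fun _ => hs, fun h => absurd h hx⟩
  choose pick hpick_le hpick_mem hpick_eq using hpick
  let proj : C → A := fun s => sInf {a | s ≤ e a}
  have hproj : ∀ s, s ≤ e (proj s) := fun s => by
    rw [he.map_sInf]
    exact le_sInf (by rintro _ ⟨a, ha, rfl⟩; exact ha)
  have hproj_le : ∀ {s a}, s ≤ e a → proj s ≤ a := fun h => sInf_le h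
  have hproj_ne : ∀ {s}, s ≠ ⊥ → proj s ≠ ⊥ := fun {s} hs h =>
    hs (le_bot_iff.1 ((hproj s).trans (by rw [h, he.map_bot])))
  have hmeet : ∀ {s a}, a ≠ ⊥ → a ≤ proj s → s ⊓ e a ≠ ⊥ := fun {s a} ha hs h => by
    have : proj s ≤ aᶜ := hproj_le (by
      rw [he.map_compl]
      exact le_compl_iff_disjoint_right.2 (disjoint_iff.2 h))
    exact ha (le_bot_iff.1 (inf_compl_self a ▸ le_inf le_rfl (hs.trans this)))
  let fold : List A → C := fun l => l.foldl (fun s a => pick (s ⊓ e a)) ⊤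
  have hfold_append : ∀ l a, fold (l ++ [a]) = pick (fold l ⊓ e a) := fun l a => by
    simp [fold]
  have hfold_le : ∀ (l : List A) (h : l ≠ []), fold l ≤ e (l.getLast h) := by
    intro l h
    obtain ⟨l, a, rfl⟩ := List.eq_nil_or_concat' l |>.resolve_left h
    rw [hfold_append, List.getLast_append_singleton]
    exact (hpick_le _).trans inf_le_right
  let σ : List A → A := fun l => if fold l = ⊥ then l.getLast?.getD ⊥ else proj (fold l)
  refine ⟨σ, fun l hl => ?_, fun b _ hb hle hσ => ?_⟩
  · have hnil : l ≠ [] := by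
      rintro rfl
      simpa using hl.1
    refine ⟨trivial, ?_⟩
    by_cases h : fold l = ⊥
    · simp only [σ, h, if_true, List.getLast?_eq_some_getLast hnil, Option.getD_some]
      exact ⟨(hl.2.2 _ (List.getLast_mem hnil)).2, fun _ => le_rfl⟩
    · simp only [σ, h, if_false]
      exact ⟨hproj_ne h, fun _ => hproj_le (hfold_le l hnil)⟩
  · let s : ℕ → C := fun n => fold (List.ofFn fun i : Fin (n + 1) => b i)
    have hs : ∀ n, s (n + 1) = pick (s n ⊓ e (b (n + 1))) := fun n => by
      simp only [s]
      rw [List.ofFn_succ', List.concat_eq_append, hfold_append]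
      rfl
    have hs_zero : s 0 = pick (e (b 0)) := by simp [s, fold]
    have hmem_zero : s 0 ∈ S := by
      rw [hs_zero]
      exact hpick_mem _ fun h => hb 0 (le_bot_iff.1 (he.le_iff.1 (h.trans he.map_bot.symm).le))
    have hodd : ∀ k, s (2 * k) ∈ S → b (2 * k + 1) = proj (s (2 * k)) ∧
        s (2 * k + 1) = s (2 * k) := by
      intro k hk
      have hbk : b (2 * k + 1) = proj (s (2 * k)) := by
        rw [hσ k]
        exact if_neg (hne _ hk)
      refine ⟨hbk, ?_⟩
      rw [hs, inf_eq_left.2 (hbk ▸ hproj _)]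
      exact hpick_eq _ hk
    have heven : ∀ k, s (2 * k) ∈ S := by
      intro k
      induction k with
      | zero => exact hmem_zero
      | succ k ih =>
        obtain ⟨hbk, hsk⟩ := hodd k ih
        show s (2 * k + 1 + 1) ∈ S
        rw [hs, hsk]
        exact hpick_mem _ (hmeet (hb _) (hbk ▸ hle (2 * k + 1)))
    have hs_anti : ∀ n, s (n + 1) ≤ s n := fun n => by
      rw [hs]
      exact (hpick_le _).trans inf_le_left
    have hsb : ∀ n, s n ≤ e (b n) := by
      rintro (_ | n)
      · rw [hs_zero]
        exact hpick_le _
      · rw [hs]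
        exact (hpick_le _).trans inf_le_right
    have hmem : ∀ n, s n ∈ S := by
      intro n
      obtain ⟨k, rfl | rfl⟩ := n.even_or_odd'
      · exact heven k
      · exact (hodd k (heven k)).2 ▸ heven k
    obtain ⟨z, hz, hzs⟩ := hclosed s hmem hs_anti
    exact ⟨proj z, trivial, hproj_ne (hne z hz), fun n => hproj_le ((hzs n).trans (hsb n))⟩

end IsCompleteEmbedding

open Heyting in
/-- A projection from a preorder `P` to the nonzero elements of `B` induces a complete embedding
of `B` into the algebra of regular lower sets of `P`. -/
theorem exists_isCompleteEmbedding_regular {B P : Type u} [CompleteBooleanAlgebra B] [Preorder P]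
    {π : P → B} (hmono : Monotone π) (hne : ∀ p, π p ≠ ⊥)
    (hproj : ∀ p b, b ≠ ⊥ → b ≤ π p → ∃ q ≤ p, π q ≤ b) (hdense : ∀ b, b ≠ ⊥ → ∃ p, π p ≤ b) :
    ∃ e : B → Regular (LowerSet P), IsCompleteEmbedding e := by
  have hle_compl : ∀ {p b}, (∀ q ≤ p, ¬ π q ≤ b) → π p ≤ bᶜ := by
    intro p b h
    by_contra hpb
    obtain ⟨q, hq, hqb⟩ := hproj p (π p ⊓ b)
      (fun h => hpb (le_compl_iff_disjoint_right.2 (disjoint_iff.2 h))) inf_le_left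
    exact h q hq (hqb.trans inf_le_right)
  have hnot_le : ∀ {q b}, π q ≤ bᶜ → ¬ π q ≤ b := fun {q b} h h' =>
    hne q (le_bot_iff.1 (inf_compl_self b ▸ le_inf h' h))
  let e : B → Regular (LowerSet P) := fun b =>
    ⟨⟨{p | π p ≤ b}, fun p q hqp hp => (hmono hqp).trans hp⟩,
      LowerSet.isRegular_of_forall fun p hp => by
        rw [← compl_compl b]
        refine hle_compl fun q hq hqb => ?_
        obtain ⟨t, ht, htb⟩ := hp q hq
        exact hnot_le ((hmono ht).trans hqb) htb⟩
  have hle : ∀ {x y}, e x ≤ e y ↔ x ≤ y := by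
    refine fun {x y} => ⟨fun h => ?_, fun h p (hp : π p ≤ x) => hp.trans h⟩
    by_contra hxy
    obtain ⟨p, hp⟩ := hdense (x ⊓ yᶜ) fun h =>
      hxy (compl_compl y ▸ le_compl_iff_disjoint_right.2 (disjoint_iff.2 h))
    exact hnot_le (hp.trans inf_le_right) (h (hp.trans inf_le_left : π p ≤ x))
  refine ⟨e, hle, fun x => ?_, fun s => ?_⟩
  · refine Regular.coe_injective (LowerSet.ext (Set.ext fun p => ?_))
    change π p ≤ xᶜ ↔ p ∈ (e x)ᶜ.val
    rw [Regular.coe_compl, LowerSet.mem_compl_iff_forall_le]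
    exact ⟨fun h q hq => hnot_le ((hmono hq).trans h), hle_compl⟩
  · refine le_antisymm (le_sInf ?_) fun p hp => ?_
    · rintro _ ⟨x, hx, rfl⟩
      exact hle.2 (sInf_le hx)
    · exact le_sInf fun x hx => (sInf_le ⟨x, hx, rfl⟩ : sInf (e '' s) ≤ e x) hp

/-- Every game-closed complete Boolean algebra embeds completely into a countably closed one. -/
theorem GameClosed.exists_isCompleteEmbedding {B : Type u} [CompleteBooleanAlgebra B]
    (hB : GameClosed B) : ∃ (C : Type u) (_ : CompleteBooleanAlgebra C) (e : B → C),
      CountablyClosed C ∧ IsCompleteEmbedding e := by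
  obtain ⟨σ, hσ⟩ := hB
  let R : StrictProjection B := hσ.historySystem.strictProjection
  obtain ⟨e, he⟩ := exists_isCompleteEmbedding_regular (P := R.Chain) (π := fun C => R.π C.min)
    (fun _ _ h => StrictProjection.Chain.min_mono h) (fun C => R.ne_bot C.min)
    (fun C _ => C.exists_le_of_le_min) (fun _ => StrictProjection.Chain.exists_min_le)
  exact ⟨_, _, e, countablyClosed_regular
    (fun _ _ => StrictProjection.Chain.le_of_forall_compatible)
    StrictProjection.Chain.exists_le_of_seq, he⟩

namespace IsCompleteSubalgebra

variable {B : Type u} [CompleteBooleanAlgebra B] {A : Set B}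

/-- A complete subalgebra is a complete Boolean algebra under the induced operations. -/
abbrev completeBooleanAlgebra (hA : IsCompleteSubalgebra A) : CompleteBooleanAlgebra A :=
  letI : Max A := ⟨fun x y => ⟨x ⊔ y, hA.2.2.2.1 x x.2 y y.2⟩⟩
  letI : Min A := ⟨fun x y => ⟨x ⊓ y, hA.2.2.2.2.1 x x.2 y y.2⟩⟩
  letI : Top A := ⟨⟨⊤, hA.2.1⟩⟩
  letI : Bot A := ⟨⟨⊥, hA.1⟩⟩
  letI : Compl A := ⟨fun x => ⟨xᶜ, hA.2.2.1 x x.2⟩⟩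
  letI : SDiff A := ⟨fun x y => x ⊓ yᶜ⟩
  letI : HImp A := ⟨fun x y => y ⊔ xᶜ⟩
  letI : SupSet A := ⟨fun s => ⟨sSup ((↑) '' s), hA.2.2.2.2.2.1 _ (by simp)⟩⟩
  letI : InfSet A := ⟨fun s => ⟨sInf ((↑) '' s), hA.2.2.2.2.2.2 _ (by simp)⟩⟩
  Subtype.val_injective.completeBooleanAlgebra _ Iff.rfl Iff.rfl (fun _ _ => rfl)
    (fun _ _ => rfl) (fun _ => sSup_image) (fun _ => sInf_image) rfl rfl (fun _ => rfl)
    (fun _ _ => himp_eq.symm) (fun _ _ => sdiff_eq.symm)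

theorem gameClosed (hA : IsCompleteSubalgebra A) (hB : CountablyClosed B) :
    letI := hA.completeBooleanAlgebra
    GameClosed A :=
  letI := hA.completeBooleanAlgebra
  IsCompleteEmbedding.gameClosed (e := ((↑) : A → B)) ⟨Iff.rfl, fun _ => rfl, fun _ => rfl⟩ hB

theorem countablyClosedOn (hA : IsCompleteSubalgebra A)
    (h : letI := hA.completeBooleanAlgebra; CountablyClosed A) : CountablyClosedOn A := by
  let := hA.completeBooleanAlgebra
  obtain ⟨S, -, hne, hdense, hclosed⟩ := h
  refine ⟨(↑) '' S, by simp, ?_, ?_, ?_⟩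
  · rintro _ ⟨s, hs, rfl⟩ h
    exact hne s hs (Subtype.ext h)
  · intro b hbA hb
    obtain ⟨s, hs, hsb⟩ := hdense ⟨b, hbA⟩ trivial fun h => hb (congrArg Subtype.val h)
    exact ⟨s, ⟨s, hs, rfl⟩, hsb⟩
  · intro f hf hle
    choose g hg hgf using hf
    obtain rfl : (fun n => (g n : B)) = f := funext hgf
    obtain ⟨z, hz, hzg⟩ := hclosed g hg hle
    exact ⟨z, ⟨z, hz, rfl⟩, hzg⟩

end IsCompleteSubalgebra

/-- "Every game-closed complete Boolean algebra is countably closed" is equivalent to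
"every complete subalgebra of a countably closed complete Boolean algebra is countably
closed". -/
theorem stmt13 :
    (∀ (B : Type u) [CompleteBooleanAlgebra B], GameClosed B → CountablyClosed B) ↔
    (∀ (B : Type u) [CompleteBooleanAlgebra B], CountablyClosed B →
      ∀ A : Set B, IsCompleteSubalgebra A → CountablyClosedOn A) := by
  refine ⟨fun h B _ hB A hA => ?_, fun h B _ hB => ?_⟩
  · let := hA.completeBooleanAlgebra
    exact hA.countablyClosedOn (h A (hA.gameClosed hB))
  · obtain ⟨C, _, e, hC, he⟩ := hB.exists_isCompleteEmbedding
    exact he.countablyClosed (h C hC _ he.isCompleteSubalgebra_range)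
end
end
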